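/- arXiv:1002.1829 — 2 statements merged into one kernel-verified Lean document; each statement's English description precedes it below -/
import Mathlib

section
/- Let v : (0,∞) → ℝ be continuously differentiable and ρ(r) = e^{−v(r)}. Let f : (0,∞) → ℝ be continuously differentiable, and suppose that for every smooth compactly supported function φ : (0,∞) → ℝ satisfying ∫_0^∞ φ(r)·r·ρ(r) dr = 0, one has ∫_0^∞ ( r² f'(r) φ'(r) / √(1 + r² f'(r)²) ) · ρ(r) dr = 0. Assume further that the function u(r) = r² f'(r) / √(1 + r² f'(r)²) is differentiable on (0,∞). Then there exists a constant c ∈ ℝ such that u'(r) − v'(r)·u(r) = c·r for all r ∈ (0,∞). -/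
open Set MeasureTheory

/-- Test functions on the open half line. -/
def IsTest (φ : ℝ → ℝ) : Prop :=
  ContDiff ℝ (⊤ : ℕ∞) φ ∧ HasCompactSupport φ ∧ tsupport φ ⊆ Ioi 0

lemma IsTest.lin {φ ψ : ℝ → ℝ} (hφ : IsTest φ) (hψ : IsTest ψ) (a : ℝ) :
    IsTest (fun x => φ x - a * ψ x) := by
  obtain ⟨h1, h2, h3⟩ := hφ
  obtain ⟨k1, k2, k3⟩ := hψ
  have hsub : tsupport (fun x => φ x - a * ψ x) ⊆ tsupport φ ∪ tsupport ψ := by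
    apply closure_minimal _ ((isClosed_tsupport φ).union (isClosed_tsupport ψ))
    intro x hx
    by_contra hcon
    simp only [mem_union, not_or] at hcon
    apply hx
    simp [image_eq_zero_of_notMem_tsupport hcon.1, image_eq_zero_of_notMem_tsupport hcon.2]
  refine ⟨h1.sub (contDiff_const.mul k1), ?_, hsub.trans (union_subset h3 k3)⟩
  exact (h2.isCompact.union k2.isCompact).of_isClosed_subset (isClosed_tsupport _) hsub

lemma IsTest.integrable {ψ g : ℝ → ℝ} (hc : Continuous ψ) (hcs : HasCompactSupport ψ)
    (hs : tsupport ψ ⊆ Ioi 0) (hg : ContinuousOn g (Ioi 0)) :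
    IntegrableOn (fun x => g x * ψ x) (Ioi 0) := by
  have h1 : IntegrableOn (fun x => g x * ψ x) (tsupport ψ) :=
    ((hg.mono hs).mul hc.continuousOn).integrableOn_compact hcs.isCompact
  rw [integrableOn_iff_integrable_of_support_subset] at h1
  · exact h1.integrableOn
  · intro x hx
    by_contra hcon
    exact hx (by simp [image_eq_zero_of_notMem_tsupport hcon])

lemma IsTest.int {φ g : ℝ → ℝ} (h : IsTest φ) (hg : ContinuousOn g (Ioi 0)) :
    IntegrableOn (fun x => g x * φ x) (Ioi 0) :=
  IsTest.integrable h.1.continuous h.2.1 h.2.2 hg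

lemma IsTest.int_deriv {φ g : ℝ → ℝ} (h : IsTest φ) (hg : ContinuousOn g (Ioi 0)) :
    IntegrableOn (fun x => g x * deriv φ x) (Ioi 0) :=
  IsTest.integrable (h.1.continuous_deriv (by simp)) h.2.1.deriv
    ((closure_minimal support_deriv_subset (isClosed_tsupport φ)).trans h.2.2) hg

lemma IsTest.parts {φ R R' : ℝ → ℝ} (h : IsTest φ)
    (hR : ∀ x ∈ Ioi (0 : ℝ), HasDerivAt R (R' x) x) (hR' : ContinuousOn R' (Ioi 0)) :
    ∫ x in Ioi (0 : ℝ), R x * deriv φ x = - ∫ x in Ioi (0 : ℝ), R' x * φ x := by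
  have hRc : ContinuousOn R (Ioi 0) := fun x hx => (hR x hx).continuousAt.continuousWithinAt
  have i1 := h.int hR'
  have i2 := h.int_deriv hRc
  have key : ∫ x in Ioi (0 : ℝ), (R' x * φ x + R x * deriv φ x) = 0 - R 0 * φ 0 := by
    refine integral_Ioi_of_hasDerivAt_of_tendsto (f := fun x => R x * φ x) ?_ ?_ (i1.add i2) ?_
    · have h0 : (0 : ℝ) ∉ tsupport φ := fun h0 => lt_irrefl (0 : ℝ) (h.2.2 h0)
      have e : (fun x => R x * φ x) =ᶠ[nhds 0] fun _ => 0 := by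
        filter_upwards [notMem_tsupport_iff_eventuallyEq.1 h0] with x hx
        simp [hx]
      exact (continuousAt_const.congr e.symm).continuousWithinAt
    · intro x hx
      exact (hR x hx).mul ((h.1.differentiable (by simp)) x).hasDerivAt
    · have e := hasCompactSupport_iff_eventuallyEq.1 h.2.1
      rw [Filter.coclosedCompact_eq_cocompact] at e
      have e2 := e.filter_mono atTop_le_cocompact
      refine tendsto_const_nhds.congr' ?_
      filter_upwards [e2] with x hx
      simp [hx]
  have h0 : φ 0 = 0 := image_eq_zero_of_notMem_tsupport fun h0 => lt_irrefl (0 : ℝ) (h.2.2 h0)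
  rw [integral_add i1 i2, h0] at key
  linarith

lemma IsTest.prim {χ : ℝ → ℝ} (h : IsTest χ) (h0 : ∫ x in Ioi (0 : ℝ), χ x = 0) :
    ∃ φ, IsTest φ ∧ deriv φ = χ := by
  have hc := h.1.continuous
  have hd : ∀ x, HasDerivAt (fun x => ∫ t in (0 : ℝ)..x, χ t) (χ x) x := fun x =>
    intervalIntegral.integral_hasDerivAt_right (hc.intervalIntegrable _ _)
      (hc.stronglyMeasurableAtFilter _ _) hc.continuousAt
  have hde : deriv (fun x => ∫ t in (0 : ℝ)..x, χ t) = χ := funext fun x => (hd x).deriv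
  obtain ⟨a, ha, hab⟩ : ∃ a > 0, ∀ x ∈ tsupport χ, a ≤ x := by
    rcases (tsupport χ).eq_empty_or_nonempty with he | hne
    · exact ⟨1, one_pos, by simp [he]⟩
    · obtain ⟨a, ha, hb⟩ := h.2.1.isCompact.exists_isLeast hne
      exact ⟨a, h.2.2 ha, hb⟩
  obtain ⟨b, hb⟩ := h.2.1.isCompact.bddAbove
  have hsub : tsupport (fun x => ∫ t in (0 : ℝ)..x, χ t) ⊆ Icc a b := by
    apply closure_minimal _ isClosed_Icc
    intro x hx
    by_contra hcon
    apply hx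
    rw [mem_Icc, not_and_or, not_le, not_le] at hcon
    rcases hcon with hxa | hbx
    · have : ∀ t ∈ uIcc (0 : ℝ) x, χ t = 0 := by
        intro t ht
        apply image_eq_zero_of_notMem_tsupport
        intro hh
        have := hab t hh
        have h2 := ht.2
        have : max 0 x < a := max_lt ha hxa
        linarith
      show ∫ t in (0 : ℝ)..x, χ t = 0
      rw [intervalIntegral.integral_congr (g := fun _ => 0) this]
      simp
    · show ∫ t in (0 : ℝ)..x, χ t = 0
      have hz : ∀ t, t ≤ 0 ∨ x < t → χ t = 0 := by
        intro t ht
        apply image_eq_zero_of_notMem_tsupport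
        intro hh
        have h1 := hb hh
        have h2 := hab t hh
        rcases ht with ht | ht <;> linarith
      by_cases hx0 : 0 ≤ x
      · rw [intervalIntegral.integral_of_le hx0]
        refine Eq.trans (setIntegral_eq_of_subset_of_forall_sdiff_eq_zero measurableSet_Ioi
          (fun t ht => ht.1) ?_).symm h0
        intro t ht
        apply hz
        right
        by_contra hh
        exact ht.2 ⟨ht.1, not_lt.1 hh⟩
      · have : ∀ t ∈ uIcc (0 : ℝ) x, χ t = 0 := by
          intro t ht
          apply hz
          left
          have h2 := ht.2
          rwa [max_eq_left (not_le.1 hx0).le] at h2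
        rw [intervalIntegral.integral_congr (g := fun _ => 0) this]
        simp
  refine ⟨fun x => ∫ t in (0 : ℝ)..x, χ t, ⟨?_, ?_, ?_⟩, hde⟩
  · rw [contDiff_infty_iff_deriv]
    exact ⟨fun x => (hd x).differentiableAt, by rw [hde]; exact h.1⟩
  · exact isCompact_Icc.of_isClosed_subset (isClosed_tsupport _) hsub
  · exact fun x hx => lt_of_lt_of_le ha (hsub hx).1

lemma lin_mult (L M : (ℝ → ℝ) → ℝ)
    (hL : ∀ φ ψ, IsTest φ → IsTest ψ → ∀ a : ℝ, L (fun x => φ x - a * ψ x) = L φ - a * L ψ)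
    (hM : ∀ φ ψ, IsTest φ → IsTest ψ → ∀ a : ℝ, M (fun x => φ x - a * ψ x) = M φ - a * M ψ)
    (h : ∀ φ, IsTest φ → M φ = 0 → L φ = 0) : ∃ c, ∀ φ, IsTest φ → L φ = c * M φ := by
  by_cases hh : ∃ φ, IsTest φ ∧ M φ ≠ 0
  · obtain ⟨p, hp, hp0⟩ := hh
    refine ⟨L p / M p, fun φ hφ => ?_⟩
    have := h _ (hφ.lin hp (M φ / M p)) (by rw [hM _ _ hφ hp]; field_simp; ring)
    rw [hL _ _ hφ hp] at this
    have h2 : L φ = M φ / M p * L p := by linarith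
    rw [h2]; ring
  · push Not at hh
    exact ⟨0, fun φ hφ => by rw [h φ hφ (hh φ hφ)]; ring⟩

lemma int_lin {g : ℝ → ℝ} (hg : ContinuousOn g (Ioi 0)) (φ ψ : ℝ → ℝ) (hφ : IsTest φ)
    (hψ : IsTest ψ) (a : ℝ) :
    ∫ x in Ioi (0 : ℝ), g x * (φ x - a * ψ x) =
      (∫ x in Ioi (0 : ℝ), g x * φ x) - a * ∫ x in Ioi (0 : ℝ), g x * ψ x := by
  rw [← integral_const_mul, ← integral_sub (hφ.int hg) ((hψ.int hg).const_mul a)]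
  congr 1; ext x; ring

lemma int_lin_deriv {g : ℝ → ℝ} (hg : ContinuousOn g (Ioi 0)) (φ ψ : ℝ → ℝ) (hφ : IsTest φ)
    (hψ : IsTest ψ) (a : ℝ) :
    ∫ x in Ioi (0 : ℝ), g x * deriv (fun x => φ x - a * ψ x) x =
      (∫ x in Ioi (0 : ℝ), g x * deriv φ x) - a * ∫ x in Ioi (0 : ℝ), g x * deriv ψ x := by
  rw [← integral_const_mul, ← integral_sub (hφ.int_deriv hg) ((hψ.int_deriv hg).const_mul a)]
  congr 1; ext x
  have h1 := ((hφ.1.differentiable (by simp)) x).hasDerivAt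
  have h2 := ((hψ.1.differentiable (by simp)) x).hasDerivAt
  rw [(h1.fun_sub (h2.const_mul a)).deriv]; ring

lemma dubois {g : ℝ → ℝ} (hg : ContinuousOn g (Ioi 0))
    (h : ∀ φ, IsTest φ → ∫ x in Ioi (0 : ℝ), g x * deriv φ x = 0) :
    ∃ k, ∀ x ∈ Ioi (0 : ℝ), g x = k := by
  obtain ⟨k, hk⟩ := lin_mult (fun φ => ∫ x in Ioi (0 : ℝ), g x * φ x)
    (fun φ => ∫ x in Ioi (0 : ℝ), 1 * φ x) (int_lin hg)
    (int_lin (g := fun _ => 1) continuousOn_const) (by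
      intro χ hχ h0
      obtain ⟨φ, hφ, rfl⟩ := hχ.prim (by simpa using h0)
      exact h φ hφ)
  refine ⟨k, ?_⟩
  have hgk : ContinuousOn (fun x => g x - k) (Ioi 0) := hg.sub continuousOn_const
  have hae : ∀ᵐ x ∂(volume : Measure ℝ), x ∈ Ioi (0 : ℝ) → g x - k = 0 := by
    apply isOpen_Ioi.ae_eq_zero_of_integral_contDiff_smul_eq_zero
      (hgk.locallyIntegrableOn measurableSet_Ioi)
    intro φ h1 h2 h3
    have hφ : IsTest φ := ⟨h1, h2, h3⟩
    have e := hk φ hφ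
    have e1 : ∫ x, φ x • (g x - k) = ∫ x in Ioi (0 : ℝ), φ x • (g x - k) := by
      rw [setIntegral_eq_integral_of_forall_compl_eq_zero]
      intro x hx
      simp [image_eq_zero_of_notMem_tsupport fun hh => hx (h3 hh)]
    rw [e1]
    have e2 : ∀ x, φ x • (g x - k) = g x * φ x - k * (1 * φ x) := by
      intro x; simp; ring
    simp_rw [e2]
    rw [integral_sub (hφ.int hg) ((hφ.int (g := fun _ => 1) continuousOn_const).const_mul k),
      integral_const_mul]
    linarith
  have := Measure.eqOn_open_of_ae_eq (μ := (volume : Measure ℝ)) (f := g) (g := fun _ => k)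
    ((ae_restrict_iff' measurableSet_Ioi).2 (hae.mono fun x hx hm => sub_eq_zero.1 (hx hm)))
    isOpen_Ioi hg continuousOn_const
  exact this

theorem stmt_2 (v v' f f' u u' : ℝ → ℝ)
    (hv : ∀ r ∈ Ioi (0 : ℝ), HasDerivAt v (v' r) r)
    (hv'cont : ContinuousOn v' (Ioi 0))
    (hf : ∀ r ∈ Ioi (0 : ℝ), HasDerivAt f (f' r) r)
    (hf'cont : ContinuousOn f' (Ioi 0))
    (hu : ∀ r ∈ Ioi (0 : ℝ), u r = r ^ 2 * f' r / Real.sqrt (1 + r ^ 2 * (f' r) ^ 2))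
    (hu' : ∀ r ∈ Ioi (0 : ℝ), HasDerivAt u (u' r) r)
    (hstat : ∀ φ : ℝ → ℝ, ContDiff ℝ (⊤ : ℕ∞) φ → HasCompactSupport φ →
      Function.support φ ⊆ Ioi 0 →
      (∫ r in Ioi (0 : ℝ), φ r * r * Real.exp (-v r)) = 0 →
      (∫ r in Ioi (0 : ℝ),
        (r ^ 2 * f' r * deriv φ r / Real.sqrt (1 + r ^ 2 * (f' r) ^ 2)) * Real.exp (-v r)) = 0) :
    ∃ c : ℝ, ∀ r ∈ Ioi (0 : ℝ), u' r - v' r * u r = c * r := by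
  have hvc : ContinuousOn v (Ioi 0) := fun x hx => (hv x hx).continuousAt.continuousWithinAt
  have huc : ContinuousOn u (Ioi 0) := fun x hx => (hu' x hx).continuousAt.continuousWithinAt
  have hρ : ContinuousOn (fun r => Real.exp (-v r)) (Ioi 0) := hvc.neg.rexp
  have hw : ContinuousOn (fun r => u r * Real.exp (-v r)) (Ioi 0) := huc.mul hρ
  have hm : ContinuousOn (fun r => r * Real.exp (-v r)) (Ioi 0) := continuousOn_id.mul hρ
  obtain ⟨c, hc⟩ := lin_mult (fun φ => ∫ x in Ioi (0 : ℝ), (u x * Real.exp (-v x)) * deriv φ x)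
    (fun φ => ∫ x in Ioi (0 : ℝ), (x * Real.exp (-v x)) * φ x) (int_lin_deriv hw)
    (int_lin hm) (by
      intro φ hφ h0
      refine Eq.trans ?_ (hstat φ hφ.1 hφ.2.1 ((subset_tsupport φ).trans hφ.2.2) (by
        refine Eq.trans ?_ h0
        congr 1; ext x; ring))
      apply setIntegral_congr_fun measurableSet_Ioi
      intro r hr
      simp only
      rw [hu r hr]; ring)
  have hR : ∀ x ∈ Ioi (0 : ℝ), HasDerivAt (fun x => ∫ t in (1 : ℝ)..x, t * Real.exp (-v t))
      (x * Real.exp (-v x)) x := by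
    intro x hx
    have hsub : uIcc 1 x ⊆ Ioi (0 : ℝ) := fun t ht =>
      lt_of_lt_of_le (lt_min one_pos hx) ht.1
    exact intervalIntegral.integral_hasDerivAt_right (hm.mono hsub).intervalIntegrable
      (hm.stronglyMeasurableAtFilter isOpen_Ioi x hx) (hm.continuousAt (Ioi_mem_nhds hx))
  have hRc : ContinuousOn (fun x => ∫ t in (1 : ℝ)..x, t * Real.exp (-v t)) (Ioi 0) :=
    fun x hx => (hR x hx).continuousAt.continuousWithinAt
  obtain ⟨k, hk⟩ := dubois (g := fun x => u x * Real.exp (-v x) +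
      c * ∫ t in (1 : ℝ)..x, t * Real.exp (-v t)) (hw.add (continuousOn_const.mul hRc)) (by
    intro φ hφ
    have e := hc φ hφ
    have p := hφ.parts hR hm
    simp only [add_mul, mul_assoc c]
    rw [integral_add (hφ.int_deriv hw) ((hφ.int_deriv hRc).const_mul c), integral_const_mul, p]
    rw [e]; ring)
  refine ⟨-c, fun r hr => ?_⟩
  have d1 := ((hu' r hr).fun_mul (hv r hr).fun_neg.exp).fun_add ((hR r hr).const_mul c)
  have d2 : HasDerivAt (fun x => u x * Real.exp (-v x) +
      c * ∫ t in (1 : ℝ)..x, t * Real.exp (-v t)) 0 r := by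
    refine (hasDerivAt_const r k).congr_of_eventuallyEq ?_
    filter_upwards [Ioi_mem_nhds hr] with x hx using hk x hx
  have e := d1.unique d2
  have hpos := Real.exp_pos (-v r)
  apply mul_right_cancel₀ hpos.ne'
  linarith
end

section
/- Let V : ℝ^d → ℝ be a convex continuously differentiable function, let μ = e^{V(x)} dx, and let A ⊂ ℝ^d be a bounded open set with smooth boundary. Then μ⁺(∂A) ≥ ∫_A |∇V(x)| dμ(x). -/
open MeasureTheory Metric Filter Set
open scoped ENNReal

/-- The (lower outer) surface measure `μ⁺(∂A) = liminf_{ε→0⁺} (μ(A^ε) − μ(A))/ε`,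
where `A^ε` is the open `ε`-neighborhood of `A`. -/
noncomputable def surfaceMeasure {X : Type*} [PseudoEMetricSpace X] [MeasurableSpace X]
    (μ : Measure X) (A : Set X) : ℝ≥0∞ :=
  Filter.liminf (fun ε : ℝ => (μ (Metric.thickening ε A) - μ A) / ENNReal.ofReal ε)
    (nhdsWithin 0 (Set.Ioi 0))

/-- `A` has smooth boundary: near every boundary point, `A` is the sublevel set of a
smooth function with nonvanishing differential. -/
def HasSmoothBoundary {d : ℕ} (A : Set (EuclideanSpace ℝ (Fin d))) : Prop :=
  ∀ x ∈ frontier A, ∃ U : Set (EuclideanSpace ℝ (Fin d)), IsOpen U ∧ x ∈ U ∧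
    ∃ g : EuclideanSpace ℝ (Fin d) → ℝ, ContDiff ℝ (⊤ : ℕ∞) g ∧ (∀ y ∈ U, fderiv ℝ g y ≠ 0) ∧
      A ∩ U = {y | g y < 0} ∩ U

open scoped Matrix MatrixOrder RealInnerProductSpace

lemma one_le_det_one_add {n : Type*} [Fintype n] [DecidableEq n] {P : Matrix n n ℝ}
    (hP : P.PosSemidef) : 1 ≤ (1 + P).det := by
  have h := hP.1.spectral_theorem
  have h2 : (1 + P).det = ∏ i, (1 + hP.1.eigenvalues i) := by
    have : 1 + P = (Unitary.conjStarAlgAut ℝ _ hP.1.eigenvectorUnitary)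
        (Matrix.diagonal (fun i => 1 + hP.1.eigenvalues i)) := by
      have h3 : (Matrix.diagonal (fun i => 1 + hP.1.eigenvalues i) : Matrix n n ℝ) 
        = 1 + Matrix.diagonal (RCLike.ofReal ∘ hP.1.eigenvalues) := by
        rw [← Matrix.diagonal_one, Matrix.diagonal_add]; rfl
      rw [h3, map_add, map_one, ← h]
    rw [this, Unitary.conjStarAlgAut_apply, Matrix.det_mul_right_comm]
    simp
  rw [h2]
  calc (1:ℝ) = ∏ i : n, (1:ℝ) := by simp
    _ ≤ _ := Finset.prod_le_prod (fun i _ => zero_le_one)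
      fun i _ => by linarith [hP.eigenvalues_nonneg i]

lemma one_le_det_comp {d : ℕ} (M H : EuclideanSpace ℝ (Fin d) →L[ℝ] EuclideanSpace ℝ (Fin d))
    (hM : M.toLinearMap.IsPositive) (hH : H.toLinearMap.IsPositive) :
    1 ≤ (ContinuousLinearMap.id ℝ _ + M.comp H).det := by
  let b := EuclideanSpace.basisFun (Fin d) ℝ
  have hM' := (LinearMap.posSemidef_toMatrix_iff b).2 hM
  have hH' := (LinearMap.posSemidef_toMatrix_iff b).2 hH
  have h1 : (ContinuousLinearMap.id ℝ _ + M.comp H).det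
     = (1 + (M.toLinearMap.toMatrix b.toBasis b.toBasis) * (H.toLinearMap.toMatrix b.toBasis b.toBasis)).det := by
    rw [ContinuousLinearMap.det, ← LinearMap.det_toMatrix b.toBasis]
    congr 1
    rw [← LinearMap.toMatrix_comp, ← LinearMap.toMatrix_one b.toBasis, ← map_add]
    rfl
  rw [h1]
  obtain ⟨B, hB⟩ : ∃ B : Matrix (Fin d) (Fin d) ℝ, (M.toLinearMap.toMatrix b.toBasis b.toBasis) = Bᴴ * B := by
    exact CStarAlgebra.nonneg_iff_eq_star_mul_self.mp hM'.nonneg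
  rw [hB, Matrix.mul_assoc, Matrix.det_one_add_mul_comm]
  exact one_le_det_one_add (hH'.mul_mul_conjTranspose_same B)

section conv
variable {d : ℕ} {V : EuclideanSpace ℝ (Fin d) → ℝ}

lemma grad_ineq (hV : ConvexOn ℝ univ V) (hd : Differentiable ℝ V)
    (x y : EuclideanSpace ℝ (Fin d)) :
    V x + ⟪gradient V x, y - x⟫ ≤ V y := by
  have hg : ConvexOn ℝ univ (V ∘ AffineMap.lineMap (k := ℝ) x y) := by
    simpa using hV.comp_affineMap (AffineMap.lineMap (k := ℝ) x y)
  have hder : HasDerivAt (V ∘ AffineMap.lineMap (k := ℝ) x y) (fderiv ℝ V x (y - x)) 0 := by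
    have h1 : HasDerivAt (AffineMap.lineMap (k := ℝ) x y) (y - x) (0:ℝ) :=
      AffineMap.hasDerivAt_lineMap
    have h2 : HasFDerivAt V (fderiv ℝ V x) (AffineMap.lineMap (k := ℝ) x y (0:ℝ)) := by
      simpa using (hd x).hasFDerivAt
    exact h2.comp_hasDerivAt _ h1
  have := hg.le_slope_of_hasDerivAt (mem_univ 0) (mem_univ 1) one_pos hder
  rw [slope_def_field] at this
  simp at this
  rw [inner_gradient_left]
  simp at this ⊢
  linarith

lemma grad_mono (hV : ConvexOn ℝ univ V) (hd : Differentiable ℝ V)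
    (x y : EuclideanSpace ℝ (Fin d)) :
    0 ≤ ⟪gradient V x - gradient V y, x - y⟫ := by
  have h1 := grad_ineq hV hd x y
  have h2 := grad_ineq hV hd y x
  rw [← neg_sub x y, inner_neg_right] at h1
  rw [inner_sub_left]
  linarith

lemma grad_contDiff (hV2 : ContDiff ℝ 2 V) : ContDiff ℝ 1 (gradient V) := by
  have : ContDiff ℝ 1 (fderiv ℝ V) := hV2.fderiv_right (by norm_num)
  exact (InnerProductSpace.toDual ℝ (EuclideanSpace ℝ (Fin d))).symm.contDiff.comp this

lemma hess_pos (hV : ConvexOn ℝ univ V) (hV2 : ContDiff ℝ 2 V) (x : EuclideanSpace ℝ (Fin d)) :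
    (fderiv ℝ (gradient V) x).toLinearMap.IsPositive := by
  have hd : Differentiable ℝ V := hV2.differentiable (by norm_num)
  have hG : HasFDerivAt (gradient V) (fderiv ℝ (gradient V) x) x :=
    ((grad_contDiff hV2).differentiable (by norm_num) x).hasFDerivAt
  have hinner : ∀ v w, ⟪fderiv ℝ (gradient V) x v, w⟫ = fderiv ℝ (fderiv ℝ V) x v w := by
    intro v w
    have h1 : fderiv ℝ V = fun y => InnerProductSpace.toDual ℝ _ (gradient V y) := by
      ext y : 1
      simp
    have h2 : HasFDerivAt (fderiv ℝ V) 
      ((InnerProductSpace.toDual ℝ (EuclideanSpace ℝ (Fin d))).toContinuousLinearEquiv.toContinuousLinearMap.comp (fderiv ℝ (gradient V) x)) x := by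
      rw [h1]
      exact (InnerProductSpace.toDual ℝ (EuclideanSpace ℝ (Fin d))).toContinuousLinearEquiv.toContinuousLinearMap.hasFDerivAt.comp x hG
    rw [h2.fderiv]
    simp
  refine ⟨fun v w => ?_, fun v => ?_⟩
  · have hs : IsSymmSndFDerivAt ℝ V x := hV2.contDiffAt.isSymmSndFDerivAt (by simp)
    simp only [ContinuousLinearMap.coe_coe]
    rw [hinner, real_inner_comm, hinner]
    exact hs v w
  · simp only [ContinuousLinearMap.coe_coe, RCLike.re_to_real]
    -- derivative of t ↦ ⟪G (x + t v), v⟫ 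
    have h1 : HasDerivAt (fun t : ℝ => ⟪gradient V (x + t • v), v⟫)
        ⟪fderiv ℝ (gradient V) x v, v⟫ 0 := by
      have h2 : HasDerivAt (fun t : ℝ => x + t • v) v 0 := by
        simpa using ((hasDerivAt_id (0:ℝ)).smul_const v).const_add x
      have h3 : HasDerivAt (fun t : ℝ => gradient V (x + t • v)) (fderiv ℝ (gradient V) x v) 0 := by
        have hG' : HasFDerivAt (gradient V) (fderiv ℝ (gradient V) x) (x + (0:ℝ) • v) := by
          simpa using hG
        exact hG'.comp_hasDerivAt (0:ℝ) h2
      simpa using h3.inner ℝ (hasDerivAt_const (0:ℝ) v)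
    have hmono : Monotone (fun t : ℝ => ⟪gradient V (x + t • v), v⟫) := by
      intro a b hab
      rcases hab.eq_or_lt with rfl | hab
      · rfl
      have := grad_mono hV hd (x + b • v) (x + a • v)
      rw [add_sub_add_left_eq_sub, ← sub_smul, inner_smul_right, inner_sub_left] at this
      have := nonneg_of_mul_nonneg_right this (sub_pos.2 hab)
      simpa using this
    rw [← h1.deriv]
    exact hmono.deriv_nonneg

/-- the normalization map -/
noncomputable def phiMap (d : ℕ) (ε δ : ℝ) (p : EuclideanSpace ℝ (Fin d)) : EuclideanSpace ℝ (Fin d) :=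
  (ε / √(‖p‖ ^ 2 + δ ^ 2)) • p

lemma phiMap_deriv {ε δ : ℝ} (hε : 0 < ε) (hδ : 0 < δ) (p : EuclideanSpace ℝ (Fin d)) :
    ∃ M : EuclideanSpace ℝ (Fin d) →L[ℝ] EuclideanSpace ℝ (Fin d),
      HasFDerivAt (phiMap d ε δ) M p ∧ M.toLinearMap.IsPositive := by
  have hpos : 0 < ‖p‖ ^ 2 + δ ^ 2 := by positivity
  set s := √(‖p‖ ^ 2 + δ ^ 2) with hs
  have hs0 : 0 < s := Real.sqrt_pos.2 hpos
  have hs2 : s ^ 2 = ‖p‖ ^ 2 + δ ^ 2 := Real.sq_sqrt hpos.le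
  refine ⟨(ε / s) • ContinuousLinearMap.id ℝ _ - (ε / s ^ 3) • (innerSL ℝ p).smulRight p, ?_, ?_, ?_⟩
  · have h1 : HasFDerivAt (fun p : EuclideanSpace ℝ (Fin d) => ‖p‖ ^ 2 + δ ^ 2) (2 • (innerSL ℝ p)) p :=
      (hasStrictFDerivAt_norm_sq p).hasFDerivAt.add_const _
    have h3 : HasDerivAt (fun r : ℝ => ε / √ r) (-ε / (2 * s ^ 3)) (‖p‖ ^ 2 + δ ^ 2) := by
      have := ((Real.hasDerivAt_sqrt hpos.ne').fun_inv (by positivity)).const_mul ε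
      simp only [← div_eq_mul_inv] at this
      convert! this using 1
      rw [← hs]
      field_simp
    have h4 := (h3.comp_hasFDerivAt p h1).smul (hasFDerivAt_id p)
    refine h4.congr_fderiv ?_
    ext1 v
    simp [← hs, smul_smul]
    rw [sub_eq_add_neg, ← neg_smul]
    congr 2
    field_simp
  · intro v w
    simp [inner_sub_left, inner_sub_right, inner_smul_left, inner_smul_right, real_inner_comm]
    left
    ring
  · intro v
    simp [inner_sub_left, inner_smul_left]
    have hcs : ⟪p, v⟫ * ⟪p, v⟫ ≤ s ^ 2 * ‖v‖ ^ 2 := by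
      have := real_inner_mul_inner_self_le p v
      rw [real_inner_self_eq_norm_sq, real_inner_self_eq_norm_sq] at this
      have h2 : ‖p‖ ^ 2 * ‖v‖ ^ 2 ≤ s ^ 2 * ‖v‖ ^ 2 := by
        gcongr
        nlinarith [sq_nonneg δ]
      linarith
    have : ε / s * ‖v‖ ^ 2 = ε / s ^ 3 * (s ^ 2 * ‖v‖ ^ 2) := by field_simp
    rw [this]
    gcongr
 
lemma step_inj {ε δ : ℝ} (hε : 0 < ε) (hδ : 0 < δ) (hV : ConvexOn ℝ univ V) (hd : Differentiable ℝ V) :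
    Function.Injective (fun x => x + phiMap d ε δ (gradient V x)) := by
  intro x y hxy
  simp only [phiMap] at hxy
  have hm := grad_mono hV hd x y
  set p := gradient V x
  set q := gradient V y
  have hS : ∀ p : EuclideanSpace ℝ (Fin d), 0 < √(‖p‖ ^ 2 + δ ^ 2) := fun p => by positivity
  have hS2 : ∀ p : EuclideanSpace ℝ (Fin d), √(‖p‖ ^ 2 + δ ^ 2) ^ 2 = ‖p‖ ^ 2 + δ ^ 2 :=
    fun p => Real.sq_sqrt (by positivity)
  have key : ∀ p q : EuclideanSpace ℝ (Fin d), ‖q‖ < ‖p‖ →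
      ε / √(‖q‖ ^ 2 + δ ^ 2) * ‖q‖ < ε / √(‖p‖ ^ 2 + δ ^ 2) * ‖p‖ := by
    intro p q h
    have hn := norm_nonneg q
    rw [div_mul_eq_mul_div, div_mul_eq_mul_div, div_lt_div_iff₀ (hS q) (hS p), mul_assoc, mul_assoc]
    apply mul_lt_mul_of_pos_left _ hε
    apply lt_of_pow_lt_pow_left₀ 2 (by positivity)
    rw [mul_pow, mul_pow, hS2, hS2]
    have : ‖q‖ ^ 2 < ‖p‖ ^ 2 := by gcongr
    nlinarith [sq_pos_of_pos hδ]
  have hxy' : x - y = (ε / √(‖q‖ ^ 2 + δ ^ 2)) • q - (ε / √(‖p‖ ^ 2 + δ ^ 2)) • p := by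
    rw [sub_eq_sub_iff_add_eq_add, hxy, add_comm]
  have htp : 0 < ε / √(‖p‖ ^ 2 + δ ^ 2) := div_pos hε (hS p)
  have htq : 0 < ε / √(‖q‖ ^ 2 + δ ^ 2) := div_pos hε (hS q)
  have k1 := key p q
  have k2 := key q p
  have heq : ‖p‖ = ‖q‖ → ε / √(‖p‖ ^ 2 + δ ^ 2) = ε / √(‖q‖ ^ 2 + δ ^ 2) := fun h => by rw [h]
  generalize ε / √(‖p‖ ^ 2 + δ ^ 2) = t at *
  generalize ε / √(‖q‖ ^ 2 + δ ^ 2) = s at *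
  have hm0 := hm
  rw [hxy'] at hm
  simp only [inner_sub_left, inner_sub_right, inner_smul_right, real_inner_self_eq_norm_sq] at hm
  rw [real_inner_comm p q] at hm
  have hcs := real_inner_le_norm p q
  have h5 : 0 ≤ (‖p‖ - ‖q‖) * (s * ‖q‖ - t * ‖p‖) := by
    have : (s + t) * ⟪p, q⟫ ≤ (s + t) * (‖p‖ * ‖q‖) := by gcongr
    nlinarith
  have h6 : ‖p‖ = ‖q‖ := by
    rcases lt_trichotomy ‖p‖ ‖q‖ with h | h | h
    · nlinarith [k2 h]
    · exact h
    · nlinarith [k1 h]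
  have h7 := heq h6
  subst h7
  rw [← smul_sub, ← neg_sub p q, smul_neg] at hxy'
  rw [hxy', inner_neg_right, inner_smul_right, real_inner_self_eq_norm_sq] at hm0
  have h8 : ‖p - q‖ = 0 := by
    by_contra h
    have : 0 < ‖p - q‖ ^ 2 := by positivity
    nlinarith
  rw [norm_eq_zero.1 h8] at hxy'
  simpa [sub_eq_zero] using hxy'

lemma smooth_case {ε δ : ℝ} (hε : 0 < ε) (hδ : 0 < δ) (hV : ConvexOn ℝ univ V)
    (hV2 : ContDiff ℝ 2 V) {A : Set (EuclideanSpace ℝ (Fin d))} (hA : MeasurableSet A) :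
    ∫⁻ x in A, ENNReal.ofReal (Real.exp (V x + ε * (‖gradient V x‖ - δ))) ≤
      ∫⁻ x in thickening ε A, ENNReal.ofReal (Real.exp (V x)) := by
  have hd : Differentiable ℝ V := hV2.differentiable (by norm_num)
  choose M hM hMp using fun p : EuclideanSpace ℝ (Fin d) => phiMap_deriv (d := d) hε hδ p
  set T := fun x => x + phiMap d ε δ (gradient V x) with hT
  have hTd : ∀ x, HasFDerivAt T (ContinuousLinearMap.id ℝ _ +
      (M (gradient V x)).comp (fderiv ℝ (gradient V) x)) x := fun x =>
    (hasFDerivAt_id x).add ((hM _).comp x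
      ((grad_contDiff hV2).differentiable (by norm_num) x).hasFDerivAt)
  have hS : ∀ p : EuclideanSpace ℝ (Fin d), 0 < √(‖p‖ ^ 2 + δ ^ 2) := fun p => by positivity
  have hS2 : ∀ p : EuclideanSpace ℝ (Fin d), √(‖p‖ ^ 2 + δ ^ 2) ^ 2 = ‖p‖ ^ 2 + δ ^ 2 :=
    fun p => Real.sq_sqrt (by positivity)
  have hsub : T '' A ⊆ thickening ε A := by
    rintro _ ⟨x, hx, rfl⟩
    rw [mem_thickening_iff]
    refine ⟨x, hx, ?_⟩
    simp only [hT, phiMap, dist_self_add_left, norm_smul, Real.norm_eq_abs, abs_of_pos (div_pos hε (hS _))]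
    rw [div_mul_eq_mul_div, div_lt_iff₀ (hS _)]
    gcongr
    apply Real.lt_sqrt_of_sq_lt
    nlinarith [sq_pos_of_pos hδ]
  refine le_trans ?_ (lintegral_mono_set hsub)
  rw [lintegral_image_eq_lintegral_abs_det_fderiv_mul volume hA
    (fun x _ => (hTd x).hasFDerivWithinAt) (step_inj hε hδ hV hd).injOn]
  refine lintegral_mono fun x => ?_
  have hdet := one_le_det_comp _ _ (hMp (gradient V x)) (hess_pos hV hV2 x)
  have h1 : V x + ε * (‖gradient V x‖ - δ) ≤ V (T x) := by
    have := grad_ineq hV hd x (T x)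
    refine le_trans ?_ this
    simp only [hT, add_sub_cancel_left, phiMap, inner_smul_right, real_inner_self_eq_norm_sq]
    rw [div_mul_eq_mul_div, mul_div_assoc]
    refine add_le_add le_rfl (mul_le_mul_of_nonneg_left ?_ hε.le)
    generalize gradient V x = p
    rw [le_div_iff₀ (hS p)]
    by_cases h : ‖p‖ ≤ δ
    · nlinarith [hS p, sq_nonneg ‖p‖]
    · have : √(‖p‖ ^ 2 + δ ^ 2) ≤ ‖p‖ + δ := by
        rw [Real.sqrt_le_left (by positivity)]
        nlinarith [norm_nonneg p]
      nlinarith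
  calc ENNReal.ofReal (Real.exp (V x + ε * (‖gradient V x‖ - δ)))
      ≤ 1 * ENNReal.ofReal (Real.exp (V (T x))) := by
        rw [one_mul]; gcongr
    _ ≤ _ := by
        gcongr
        rw [← ENNReal.ofReal_one]
        exact ENNReal.ofReal_le_ofReal (hdet.trans (le_abs_self _))
end conv

section moll
open scoped Convolution Topology
variable {d : ℕ} {V : EuclideanSpace ℝ (Fin d) → ℝ}

/-- mollification -/
noncomputable def moll {F : Type*} [NormedAddCommGroup F] [NormedSpace ℝ F]
    (φ : ContDiffBump (0 : EuclideanSpace ℝ (Fin d)))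
    (V : EuclideanSpace ℝ (Fin d) → F) : EuclideanSpace ℝ (Fin d) → F :=
  (φ.normed volume) ⋆[ContinuousLinearMap.lsmul ℝ ℝ, volume] V

lemma moll_apply {F : Type*} [NormedAddCommGroup F] [NormedSpace ℝ F]
    (φ : ContDiffBump (0 : EuclideanSpace ℝ (Fin d)))
    (V : EuclideanSpace ℝ (Fin d) → F) (x) :
    moll φ V x = ∫ y, φ.normed volume y • V (x - y) := rfl

lemma moll_integrable {F : Type*} [NormedAddCommGroup F] [NormedSpace ℝ F]
    (φ : ContDiffBump (0 : EuclideanSpace ℝ (Fin d)))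
    {V : EuclideanSpace ℝ (Fin d) → F} (hV : Continuous V) (x) :
    Integrable (fun y => φ.normed volume y • V (x - y)) := by
  apply Continuous.integrable_of_hasCompactSupport
  · exact φ.continuous_normed.smul (by fun_prop)
  · exact φ.hasCompactSupport_normed.smul_right

lemma moll_contDiff (φ : ContDiffBump (0 : EuclideanSpace ℝ (Fin d))) (hV : Continuous V) :
    ContDiff ℝ 2 (moll φ V) :=
  φ.hasCompactSupport_normed.contDiff_convolution_left _ φ.contDiff_normed hV.locallyIntegrable

lemma moll_convex (φ : ContDiffBump (0 : EuclideanSpace ℝ (Fin d))) (hV : Continuous V)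
    (hc : ConvexOn ℝ univ V) : ConvexOn ℝ univ (moll φ V) := by
  refine ⟨convex_univ, fun x _ y _ a b ha hb hab => ?_⟩
  simp only [moll_apply, ← integral_const_mul, smul_eq_mul]
  have i1 := (moll_integrable φ hV x).const_mul a
  have i2 := (moll_integrable φ hV y).const_mul b
  simp only [smul_eq_mul] at i1 i2
  rw [← integral_add i1 i2]
  refine integral_mono (moll_integrable φ hV _) (i1.add i2) fun z => ?_
  have h := hc.2 (mem_univ (x - z)) (mem_univ (y - z)) ha hb hab
  have h2 : a • (x - z) + b • (y - z) = a • x + b • y - z := by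
    have : z = (a + b) • z := by rw [hab, one_smul]
    conv_rhs => rw [this]
    module
  rw [h2] at h
  have := mul_le_mul_of_nonneg_left h (φ.nonneg_normed (μ := volume) z)
  simp only [smul_eq_mul] at this ⊢
  linarith

lemma moll_hasFDerivAt (φ : ContDiffBump (0 : EuclideanSpace ℝ (Fin d))) (hV : ContDiff ℝ 1 V)
    (x : EuclideanSpace ℝ (Fin d)) :
    HasFDerivAt (moll φ V) (moll φ (fderiv ℝ V) x) x := by
  have hf : Continuous (fderiv ℝ V) := hV.continuous_fderiv (by norm_num)
  obtain ⟨C, hC⟩ := (isCompact_closedBall x (1 + φ.rOut)).exists_bound_of_continuousOn hf.continuousOn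
  refine hasFDerivAt_integral_of_dominated_of_fderiv_le (s := ball x 1)
    (F := fun x y => φ.normed volume y • V (x - y))
    (F' := fun x y => φ.normed volume y • fderiv ℝ V (x - y))
    (bound := fun y => φ.normed volume y * C) (ball_mem_nhds x one_pos) ?_ ?_ ?_ ?_ ?_ ?_
  · exact Eventually.of_forall fun z => (moll_integrable φ hV.continuous z).aestronglyMeasurable
  · exact moll_integrable φ hV.continuous x
  · exact (moll_integrable φ hf x).aestronglyMeasurable
  · refine Eventually.of_forall fun y z hz => ?_
    rw [norm_smul, Real.norm_of_nonneg (φ.nonneg_normed y)]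
    by_cases hy : y ∈ ball 0 φ.rOut
    · refine mul_le_mul_of_nonneg_left (hC _ ?_) (φ.nonneg_normed y)
      rw [mem_ball, dist_eq_norm] at hz
      rw [mem_ball_zero_iff] at hy
      rw [mem_closedBall, dist_eq_norm]
      calc ‖z - y - x‖ = ‖(z - x) - y‖ := by congr 1; abel
        _ ≤ ‖z - x‖ + ‖y‖ := norm_sub_le _ _
        _ ≤ _ := by linarith
    · have : φ.normed volume y = 0 := by
        rw [← φ.support_normed_eq (μ := volume)] at hy
        simpa using hy
      simp [this]
  · exact φ.integrable_normed.mul_const C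
  · refine Eventually.of_forall fun y z _ => ?_
    have h1 : HasFDerivAt V (fderiv ℝ V (z - y)) (z - y) :=
      (hV.differentiable (by norm_num) _).hasFDerivAt
    have h2 : HasFDerivAt (fun z => V (z - y)) (fderiv ℝ V (z - y)) z := 
      (h1.comp z ((hasFDerivAt_id z).sub_const y)).congr_fderiv (by ext; simp)
    exact h2.fun_const_smul _

lemma c1_case {ε : ℝ} (hε : 0 < ε) (hc : ConvexOn ℝ univ V)
    (hV : ContDiff ℝ 1 V) {A : Set (EuclideanSpace ℝ (Fin d))} (hA : MeasurableSet A)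
    (hb : Bornology.IsBounded A) :
    ∫⁻ x in A, ENNReal.ofReal (Real.exp (V x + ε * ‖gradient V x‖)) ≤
      ∫⁻ x in thickening ε A, ENNReal.ofReal (Real.exp (V x)) := by
  have hf : Continuous (fderiv ℝ V) := hV.continuous_fderiv (by norm_num)
  let r : ℕ → ℝ := fun n => 1 / ((n : ℝ) + 1)
  have hr0 : ∀ n, 0 < r n := fun n => by positivity
  have hr1 : ∀ n, r n ≤ 1 := fun n => by
    simp only [r]
    rw [div_le_one (by positivity)]
    linarith [Nat.cast_nonneg (α := ℝ) n]
  have hr : Tendsto r atTop (𝓝 0) := tendsto_one_div_add_atTop_nhds_zero_nat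
  let φ : ℕ → ContDiffBump (0 : EuclideanSpace ℝ (Fin d)) := fun n =>
    ⟨r n / 2, r n, half_pos (hr0 n), half_lt_self (hr0 n)⟩
  have hφ : Tendsto (fun n => (φ n).rOut) atTop (𝓝 0) := hr
  have hlim : ∀ x, Tendsto (fun n => moll (φ n) V x) atTop (𝓝 (V x)) := fun x =>
    ContDiffBump.convolution_tendsto_right_of_continuous hφ hV.continuous x
  have hlim' : ∀ x, Tendsto (fun n => gradient (moll (φ n) V) x) atTop (𝓝 (gradient V x)) := by
    intro x
    have h1 : Tendsto (fun n => moll (φ n) (fderiv ℝ V) x) atTop (𝓝 (fderiv ℝ V x)) :=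
      ContDiffBump.convolution_tendsto_right_of_continuous hφ hf x
    have h2 := ((InnerProductSpace.toDual ℝ (EuclideanSpace ℝ (Fin d))).symm.continuous.tendsto _).comp h1
    refine h2.congr fun n => ?_
    simp only [Function.comp, gradient, (moll_hasFDerivAt (φ n) hV x).fderiv]
  have hn : ∀ n, ∫⁻ x in A, ENNReal.ofReal (Real.exp (moll (φ n) V x + ε * (‖gradient (moll (φ n) V) x‖ - r n))) ≤
      ∫⁻ x in thickening ε A, ENNReal.ofReal (Real.exp (moll (φ n) V x)) := fun n =>
    smooth_case hε (hr0 n) (moll_convex (φ n) hV.continuous hc) (moll_contDiff (φ n) hV.continuous) hA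
  have hcont : ∀ n, Continuous (moll (φ n) V) := fun n => (moll_contDiff (φ n) hV.continuous).continuous
  have hcontg : ∀ n, Continuous (gradient (moll (φ n) V)) := fun n =>
    (grad_contDiff (moll_contDiff (φ n) hV.continuous)).continuous
  -- right side converges
  have hR : Tendsto (fun n => ∫⁻ x in thickening ε A, ENNReal.ofReal (Real.exp (moll (φ n) V x))) atTop
      (𝓝 (∫⁻ x in thickening ε A, ENNReal.ofReal (Real.exp (V x)))) := by
    obtain ⟨R, hR⟩ := (hb.thickening (δ := ε)).subset_closedBall 0
    obtain ⟨C, hC⟩ := (isCompact_closedBall (0 : EuclideanSpace ℝ (Fin d)) (R + 1)).exists_bound_of_continuousOn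
      hV.continuous.continuousOn
    refine tendsto_lintegral_of_dominated_convergence (fun _ => ENNReal.ofReal (Real.exp (3 * C))) ?_ ?_ ?_ ?_
    · intro n
      have := hcont n
      fun_prop
    · intro n
      refine (ae_restrict_iff' isOpen_thickening.measurableSet).2 (Eventually.of_forall fun x hx => ?_)
      refine ENNReal.ofReal_le_ofReal (Real.exp_le_exp.2 ?_)
      have hxR := hR hx
      rw [mem_closedBall_zero_iff] at hxR
      have hx0 : ‖V x‖ ≤ C := hC x (by rw [mem_closedBall_zero_iff]; linarith)
      have h1 : dist (moll (φ n) V x) (V x) ≤ 2 * C := by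
        refine ContDiffBump.dist_normed_convolution_le hV.continuous.aestronglyMeasurable fun y hy => ?_
        have hy' : ‖V y‖ ≤ C := by
          refine hC y ?_
          rw [mem_closedBall_zero_iff]
          have h2 : dist y x < r n := hy
          rw [dist_eq_norm] at h2
          have := norm_le_norm_add_norm_sub' y x
          linarith [hr1 n]
        rw [dist_eq_norm]
        linarith [norm_sub_le (V y) (V x)]
      rw [Real.dist_eq] at h1
      rw [Real.norm_eq_abs] at hx0
      linarith [le_abs_self (moll (φ n) V x - V x), le_abs_self (V x)]
    · rw [lintegral_const]
      refine ENNReal.mul_ne_top ENNReal.ofReal_ne_top ?_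
      rw [Measure.restrict_apply_univ]
      exact (hb.thickening).measure_lt_top.ne
    · refine Eventually.of_forall fun x => ?_
      exact (ENNReal.continuous_ofReal.tendsto _).comp ((Real.continuous_exp.tendsto _).comp (hlim x))
  calc ∫⁻ x in A, ENNReal.ofReal (Real.exp (V x + ε * ‖gradient V x‖)) 
      = ∫⁻ x in A, liminf (fun n => ENNReal.ofReal (Real.exp (moll (φ n) V x + ε * (‖gradient (moll (φ n) V) x‖ - r n)))) atTop := by
        refine lintegral_congr fun x => (Tendsto.liminf_eq ?_).symm
        refine (ENNReal.continuous_ofReal.tendsto _).comp ((Real.continuous_exp.tendsto _).comp ?_)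
        have := (hlim x).add (((hlim' x).norm.sub hr).const_mul ε)
        simpa using this
    _ ≤ liminf (fun n => ∫⁻ x in A, ENNReal.ofReal (Real.exp (moll (φ n) V x + ε * (‖gradient (moll (φ n) V) x‖ - r n)))) atTop := by
        refine lintegral_liminf_le fun n => ?_
        have := hcont n
        have := hcontg n
        fun_prop
    _ ≤ liminf (fun n => ∫⁻ x in thickening ε A, ENNReal.ofReal (Real.exp (moll (φ n) V x))) atTop :=
        liminf_le_liminf (Eventually.of_forall hn)
    _ = _ := hR.liminf_eq
end moll

theorem stmt_5 (d : ℕ) (V : EuclideanSpace ℝ (Fin d) → ℝ)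
    (hVconv : ConvexOn ℝ Set.univ V) (hVsmooth : ContDiff ℝ 1 V)
    (A : Set (EuclideanSpace ℝ (Fin d)))
    (hAbd : Bornology.IsBounded A) (hAopen : IsOpen A) (hAsm : HasSmoothBoundary A) :
    (∫⁻ x in A, ENNReal.ofReal ‖gradient V x‖
        ∂(volume.withDensity fun x => ENNReal.ofReal (Real.exp (V x)))) ≤
      surfaceMeasure (volume.withDensity fun x => ENNReal.ofReal (Real.exp (V x))) A := by
  have hVc : Continuous V := hVsmooth.continuous
  have hgc : Continuous (gradient V) :=
    (InnerProductSpace.toDual ℝ (EuclideanSpace ℝ (Fin d))).symm.continuous.comp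
      (hVsmooth.continuous_fderiv (by norm_num))
  have hm : Measurable fun x => ENNReal.ofReal (Real.exp (V x)) := by fun_prop
  unfold surfaceMeasure
  refine le_liminf_of_le (by isBoundedDefault) ?_
  filter_upwards [self_mem_nhdsWithin] with ε hε
  have hε : 0 < ε := hε
  rw [ENNReal.le_div_iff_mul_le (Or.inl (by simpa using hε)) (Or.inl ENNReal.ofReal_ne_top)]
  rw [withDensity_apply _ hAopen.measurableSet, withDensity_apply _ isOpen_thickening.measurableSet]
  have hfin : ∫⁻ x in A, ENNReal.ofReal (Real.exp (V x)) ≠ ∞ := by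
    have hK : IsCompact (closure A) := hAbd.isCompact_closure
    obtain ⟨C, hC⟩ := hK.exists_bound_of_continuousOn hVc.continuousOn
    refine ne_top_of_le_ne_top (b := ∫⁻ x in A, ENNReal.ofReal (Real.exp C)) ?_ ?_
    · rw [lintegral_const, Measure.restrict_apply_univ]
      exact ENNReal.mul_ne_top ENNReal.ofReal_ne_top hAbd.measure_lt_top.ne
    · refine setLIntegral_mono' hAopen.measurableSet fun x hx => ?_
      exact ENNReal.ofReal_le_ofReal (Real.exp_le_exp.2
        ((le_abs_self _).trans (hC x (subset_closure hx))))
  refine ENNReal.le_sub_of_add_le_left hfin ?_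
  refine le_trans ?_ (c1_case hε hVconv hVsmooth hAopen.measurableSet hAbd)
  rw [restrict_withDensity hAopen.measurableSet,
    lintegral_withDensity_eq_lintegral_mul _ hm (by fun_prop),
    ← lintegral_mul_const _ (by fun_prop), ← lintegral_add_left hm]
  refine lintegral_mono fun x => ?_
  simp only [Pi.mul_apply]
  rw [← ENNReal.ofReal_mul (by positivity), ← ENNReal.ofReal_mul (by positivity),
    ← ENNReal.ofReal_add (by positivity) (by positivity)]
  refine ENNReal.ofReal_le_ofReal ?_
  rw [Real.exp_add]
  nlinarith [Real.add_one_le_exp (ε * ‖gradient V x‖), Real.exp_pos (V x)]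
end
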